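/- Let Ω ⊂ ℝ² be a bounded, open, simply connected domain satisfying Assumption (R), and let ψ₀ be the scalar potential of B. If inf_Ω ψ₀ < 0, then 2(inf_Ω ψ₀ − sup_Ω ψ₀) ≤ liminf_{h→0⁺} h·log λ₋^D(h,B,Ω) ≤ limsup_{h→0⁺} h·log λ₋^D(h,B,Ω) ≤ 2·inf_Ω ψ₀. -/

import Mathlib

open MeasureTheory Set Filter Topology

noncomputable section

/-- First partial derivative (in the direction `x₁`) of a function on `ℝ × ℝ`. -/
def pd1 {E : Type*} [NormedAddCommGroup E] [NormedSpace ℝ E] (u : ℝ × ℝ → E) (x : ℝ × ℝ) : E :=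
  fderiv ℝ u x (1, 0)

/-- Second partial derivative (in the direction `x₂`) of a function on `ℝ × ℝ`. -/
def pd2 {E : Type*} [NormedAddCommGroup E] [NormedSpace ℝ E] (u : ℝ × ℝ → E) (x : ℝ × ℝ) : E :=
  fderiv ℝ u x (0, 1)

/-- The Laplacian on `ℝ × ℝ`. -/
def lap (ψ : ℝ × ℝ → ℝ) (x : ℝ × ℝ) : ℝ := pd1 (pd1 ψ) x + pd2 (pd2 ψ) x

/-- Test functions for the Dirichlet variational problems on `Ω`:
nonzero smooth compactly supported functions with support in `Ω`. -/
def IsTestFun (Ω : Set (ℝ × ℝ)) (u : ℝ × ℝ → ℂ) : Prop :=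
  ContDiff ℝ (⊤ : ℕ∞) u ∧ HasCompactSupport u ∧ tsupport u ⊆ Ω ∧ u ≠ 0

/-- Rayleigh quotient of the spin-`σ` (`σ = -1` : spin-down, `σ = 1` : spin-up)
Dirichlet Pauli operator at the test function `u`. -/
def pauliRayleigh (σ : ℝ) (h : ℝ) (A : ℝ × ℝ → ℝ × ℝ) (B : ℝ × ℝ → ℝ) (Ω : Set (ℝ × ℝ))
    (u : ℝ × ℝ → ℂ) : ℝ :=
  ((∫ x in Ω, (‖(h : ℂ) * pd1 u x - Complex.I * ((A x).1 : ℂ) * u x‖ ^ 2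
      + ‖(h : ℂ) * pd2 u x - Complex.I * ((A x).2 : ℂ) * u x‖ ^ 2))
    + σ * (h * ∫ x in Ω, B x * ‖u x‖ ^ 2)) / ∫ x in Ω, ‖u x‖ ^ 2

/-- The ground state energy `λ₋^D(h,A,B,Ω)` of the spin-down Dirichlet Pauli operator. -/
def lambdaMinusD (h : ℝ) (A : ℝ × ℝ → ℝ × ℝ) (B : ℝ × ℝ → ℝ) (Ω : Set (ℝ × ℝ)) : ℝ :=
  sInf (pauliRayleigh (-1) h A B Ω '' {u | IsTestFun Ω u})

/-- The ground state energy `λ₊^D(h,A,B,Ω)` of the spin-up Dirichlet Pauli operator. -/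
def lambdaPlusD (h : ℝ) (A : ℝ × ℝ → ℝ × ℝ) (B : ℝ × ℝ → ℝ) (Ω : Set (ℝ × ℝ)) : ℝ :=
  sInf (pauliRayleigh 1 h A B Ω '' {u | IsTestFun Ω u})

/-- The ground state energy `Λ^D(h,A,B,Ω)` of the full Dirichlet Pauli operator. -/
def LambdaD (h : ℝ) (A : ℝ × ℝ → ℝ × ℝ) (B : ℝ × ℝ → ℝ) (Ω : Set (ℝ × ℝ)) : ℝ :=
  min (lambdaMinusD h A B Ω) (lambdaPlusD h A B Ω)

/-- The canonical vector potential `∇⊥ψ = (−∂₂ψ, ∂₁ψ)`. -/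
def perpGrad (ψ : ℝ × ℝ → ℝ) (x : ℝ × ℝ) : ℝ × ℝ := (-(pd2 ψ x), pd1 ψ x)

/-- `ψ` is the scalar potential of `B` on `Ω`: `ψ ∈ C⁰(closure Ω) ∩ C²(Ω)`,
`Δψ = B` in `Ω` and `ψ = 0` on `∂Ω`. -/
structure IsScalarPotential (Ω : Set (ℝ × ℝ)) (B : ℝ × ℝ → ℝ) (ψ : ℝ × ℝ → ℝ) : Prop where
  contOn : ContinuousOn ψ (closure Ω)
  c2 : ContDiffOn ℝ 2 ψ Ω
  lap_eq : ∀ x ∈ Ω, lap ψ x = B x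
  bdry : ∀ x ∈ frontier Ω, ψ x = 0

/-- `A` is a continuous vector potential for `B` on `Ω`: `∂₁A₂ − ∂₂A₁ = B`. -/
def IsVectorPotential (Ω : Set (ℝ × ℝ)) (B : ℝ × ℝ → ℝ) (A : ℝ × ℝ → ℝ × ℝ) : Prop :=
  ContinuousOn A Ω ∧ ∀ x ∈ Ω, pd1 (fun y => (A y).2) x - pd2 (fun y => (A y).1) x = B x

/-- `γ` is a regular curve of class `C^{2,α}` on the parameter set `s`. -/
def C2HolderOn (α : ℝ) (γ : ℝ → ℝ × ℝ) (s : Set ℝ) : Prop :=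
  ContDiffOn ℝ 2 γ s ∧
  (∃ C : ℝ, ∀ x ∈ s, ∀ y ∈ s,
      ‖derivWithin (derivWithin γ s) s x - derivWithin (derivWithin γ s) s y‖ ≤ C * |x - y| ^ α) ∧
  ∀ x ∈ s, derivWithin γ s x ≠ 0

/-- Near `p`, the set `Γ` is a regular curve of class `C^{2,α}`. -/
def IsLocallyC2CurveAt (α : ℝ) (Γ : Set (ℝ × ℝ)) (p : ℝ × ℝ) : Prop :=
  ∃ ε > 0, ∃ γ : ℝ → ℝ × ℝ, C2HolderOn α γ (Icc (-1) 1) ∧ γ 0 = p ∧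
    Γ ∩ Metric.ball p ε = γ '' Ioo (-1) 1 ∩ Metric.ball p ε

/-- `Γ` is (locally) a regular curve of class `C^{2,α}`. -/
def IsC2HolderSet (α : ℝ) (Γ : Set (ℝ × ℝ)) : Prop := ∀ p ∈ Γ, IsLocallyC2CurveAt α Γ p

/-- `Ω` has a corner at `p` formed by two `C^{2,α}` arcs, of aperture less than `π`
(near `p`, `Ω` is contained in a strictly convex open cone with vertex `p`). -/
def HasConvexCornerAt (Ω : Set (ℝ × ℝ)) (α : ℝ) (p : ℝ × ℝ) : Prop :=
  ∃ ε > 0, (∃ γ₁ γ₂ : ℝ → ℝ × ℝ, C2HolderOn α γ₁ (Icc 0 1) ∧ C2HolderOn α γ₂ (Icc 0 1) ∧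
      γ₁ 0 = p ∧ γ₂ 0 = p ∧
      frontier Ω ∩ Metric.ball p ε = (γ₁ '' Ico 0 1 ∪ γ₂ '' Ico 0 1) ∩ Metric.ball p ε) ∧
    ∃ w : ℝ × ℝ, ∃ c > 0, ∀ x ∈ Ω ∩ Metric.ball p ε,
      c * ‖x - p‖ ≤ (x - p).1 * w.1 + (x - p).2 * w.2

/-- `Ω` has a continuous boundary which is piecewise of class `C^{2,α}` for some `α > 0`,
with at most finitely many corners, each of aperture less than `π`. -/
def HasPiecewiseC2Boundary (Ω : Set (ℝ × ℝ)) : Prop :=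
  ∃ α > 0, ∃ S : Finset (ℝ × ℝ), ↑S ⊆ frontier Ω ∧
    (∀ p ∈ frontier Ω \ (S : Set (ℝ × ℝ)), IsLocallyC2CurveAt α (frontier Ω) p) ∧
    ∀ p ∈ S, HasConvexCornerAt Ω α p

/-- Assumption (R): `Ω` is bounded and open with continuous, piecewise `C^{2,α}` boundary
having finitely many corners of aperture `< π`, and `B` extends continuously to `closure Ω`. -/
structure AssumptionR (Ω : Set (ℝ × ℝ)) (B : ℝ × ℝ → ℝ) : Prop where
  isOpen : IsOpen Ω
  bounded : Bornology.IsBounded Ω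
  bdryReg : HasPiecewiseC2Boundary Ω
  fieldCont : ContinuousOn B (closure Ω)

/-- The oscillation of `ψ` over `Ω`. -/
def osc (ψ : ℝ × ℝ → ℝ) (Ω : Set (ℝ × ℝ)) : ℝ := sSup (ψ '' Ω) - sInf (ψ '' Ω)

/-- The region enclosed by `Γ`: the union of the bounded connected components of `Γᶜ`. -/
def curveInterior (Γ : Set (ℝ × ℝ)) : Set (ℝ × ℝ) :=
  {x | x ∉ Γ ∧ Bornology.IsBounded (connectedComponentIn Γᶜ x)}

/-- `Γ` is a simple closed curve of class `C^{2,α}`. -/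
def IsC2ClosedCurve (α : ℝ) (Γ : Set (ℝ × ℝ)) : Prop :=
  ∃ γ : ℝ → ℝ × ℝ, Function.Periodic γ 1 ∧ C2HolderOn α γ (Icc 0 1) ∧
    InjOn γ (Ico 0 1) ∧ Γ = γ '' Icc 0 1

/-- The ground state energy `λ^D(Ω)` of the Dirichlet Laplacian on `Ω`. -/
def dirichletGSE (Ω : Set (ℝ × ℝ)) : ℝ :=
  sInf ((fun u : ℝ × ℝ → ℝ =>
      (∫ x in Ω, (pd1 u x ^ 2 + pd2 u x ^ 2)) / ∫ x in Ω, u x ^ 2) ''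
    {u | ContDiff ℝ (⊤ : ℕ∞) u ∧ HasCompactSupport u ∧ tsupport u ⊆ Ω ∧ u ≠ 0})

/-- The open disc of radius `R` centred at the origin (with the Euclidean distance). -/
def disc (R : ℝ) : Set (ℝ × ℝ) := {y : ℝ × ℝ | y.1 ^ 2 + y.2 ^ 2 < R ^ 2}

end

theorem ContinuousOn.continuous_mul_of_tsupport_subset {X R : Type*} [TopologicalSpace X]
    [NormedRing R] {Ω : Set X} {g u : X → R}
    (hΩ : IsOpen Ω) (hg : ContinuousOn g Ω) (hu : Continuous u) (hs : tsupport u ⊆ Ω) :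
    Continuous fun x => g x * u x := by
  refine continuous_of_tsupport fun x hx => ?_
  have hx' : x ∈ tsupport u := closure_mono (Function.support_mul_subset_right g u) hx
  exact (hg.continuousAt (hΩ.mem_nhds (hs hx'))).mul hu.continuousAt

theorem ContDiffOn.contDiff_mul_of_tsupport_subset {E R : Type*} [NormedAddCommGroup E]
    [NormedSpace ℝ E] [NormedRing R] [NormedAlgebra ℝ R] {n : ℕ∞}
    {Ω : Set E} {g u : E → R} (hΩ : IsOpen Ω) (hg : ContDiffOn ℝ n g Ω)
    (hu : ContDiff ℝ n u) (hs : tsupport u ⊆ Ω) : ContDiff ℝ n fun x => g x * u x := by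
  refine contDiff_iff_contDiffAt.2 fun x => ?_
  by_cases hx : x ∈ tsupport u
  · exact (hg.contDiffAt (hΩ.mem_nhds (hs hx))).mul hu.contDiffAt
  · refine (contDiffAt_const (c := (0 : R))).congr_of_eventuallyEq ?_
    filter_upwards [(notMem_tsupport_iff_eventuallyEq.1 hx)] with y hy
    simp [hy]

theorem ContDiffOn.fderiv_apply_of_isOpen {E F : Type*} [NormedAddCommGroup E]
    [NormedSpace ℝ E] [NormedAddCommGroup F] [NormedSpace ℝ F] {Ω : Set E} {f : E → F}
    {m n : ℕ∞} (hf : ContDiffOn ℝ n f Ω) (hΩ : IsOpen Ω) (hmn : m + 1 ≤ n) (v : E) :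
    ContDiffOn ℝ m (fun x => fderiv ℝ f x v) Ω :=
  (hf.fderiv_of_isOpen hΩ (by exact_mod_cast hmn)).clm_apply contDiffOn_const

/-- The integral of a directional derivative of a compactly supported function vanishes. -/
theorem integral_fderiv_eq_zero_of_hasCompactSupport {f : ℝ × ℝ → ℝ} (hf : ContDiff ℝ 1 f)
    (hc : HasCompactSupport f) (v : ℝ × ℝ) : ∫ x, fderiv ℝ f x v = 0 := by
  have hd : Continuous fun x => fderiv ℝ f x v := (hf.continuous_fderiv (by simp)).clm_apply
    continuous_const
  have hdc : HasCompactSupport fun x => fderiv ℝ f x v := hc.fderiv_apply ℝ v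
  have := integral_mul_fderiv_eq_neg_fderiv_mul_of_integrable (μ := (volume : Measure (ℝ × ℝ)))
    (𝕜 := ℝ) (f := fun _ => 1) (g := f) (v := v) (by simp)
    (by simpa using hd.integrable_of_hasCompactSupport hdc)
    (by simpa using hf.continuous.integrable_of_hasCompactSupport hc)
    (fun x _ => by fun_prop) (fun x _ => (hf.differentiable (by simp)) x)
  simpa using this

theorem fderiv_fderiv_apply_comm {f : ℝ × ℝ → ℝ} (hf : ContDiff ℝ 2 f) (x v w : ℝ × ℝ) :
    fderiv ℝ (fun y => fderiv ℝ f y v) x w = fderiv ℝ (fun y => fderiv ℝ f y w) x v := by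
  have hd : DifferentiableAt ℝ (fderiv ℝ f) x :=
    (hf.contDiffAt.fderiv_right (m := 1) (by norm_num)).differentiableAt (by simp)
  have hs : IsSymmSndFDerivAt ℝ f x := hf.contDiffAt.isSymmSndFDerivAt (by simp)
  rw [fderiv_clm_apply hd (by fun_prop), fderiv_clm_apply hd (by fun_prop)]
  simpa using hs w v

theorem pd1_eq_zero_of_notMem_tsupport {E : Type*} [NormedAddCommGroup E] [NormedSpace ℝ E]
    {u : ℝ × ℝ → E} {x : ℝ × ℝ} (hx : x ∉ tsupport u) : pd1 u x = 0 := by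
  simp [pd1, fderiv_of_notMem_tsupport ℝ hx]

theorem pd2_eq_zero_of_notMem_tsupport {E : Type*} [NormedAddCommGroup E] [NormedSpace ℝ E]
    {u : ℝ × ℝ → E} {x : ℝ × ℝ} (hx : x ∉ tsupport u) : pd2 u x = 0 := by
  simp [pd2, fderiv_of_notMem_tsupport ℝ hx]

theorem ContDiff.pd1 {E : Type*} [NormedAddCommGroup E] [NormedSpace ℝ E]
    {u : ℝ × ℝ → E} {m n : ℕ∞} (hu : ContDiff ℝ n u) (hmn : m + 1 ≤ n) : ContDiff ℝ m (pd1 u) :=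
  (hu.fderiv_right (by exact_mod_cast hmn)).clm_apply contDiff_const

theorem ContDiff.pd2 {E : Type*} [NormedAddCommGroup E] [NormedSpace ℝ E]
    {u : ℝ × ℝ → E} {m n : ℕ∞} (hu : ContDiff ℝ n u) (hmn : m + 1 ≤ n) : ContDiff ℝ m (pd2 u) :=
  (hu.fderiv_right (by exact_mod_cast hmn)).clm_apply contDiff_const

theorem fderiv_apply_eq_re_add_im {u : ℝ × ℝ → ℂ} {x : ℝ × ℝ} (hu : DifferentiableAt ℝ u x)
    (v : ℝ × ℝ) : fderiv ℝ u x v = (fderiv ℝ (fun y => (u y).re) x v : ℂ)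
      + Complex.I * (fderiv ℝ (fun y => (u y).im) x v : ℂ) := by
  have hre : fderiv ℝ (fun y => (u y).re) x = Complex.reCLM ∘L fderiv ℝ u x :=
    (Complex.reCLM.hasFDerivAt.comp x hu.hasFDerivAt).fderiv
  have him : fderiv ℝ (fun y => (u y).im) x = Complex.imCLM ∘L fderiv ℝ u x :=
    (Complex.imCLM.hasFDerivAt.comp x hu.hasFDerivAt).fderiv
  rw [hre, him]
  apply Complex.ext <;> simp

/-- The first order operator `h(∂₁ + i∂₂) + (∂₁ψ + i∂₂ψ) = e^{-ψ/h} h(∂₁ + i∂₂) e^{ψ/h}`. -/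
noncomputable def twistedDbar (h : ℝ) (ψ : ℝ × ℝ → ℝ) (u : ℝ × ℝ → ℂ) (x : ℝ × ℝ) : ℂ :=
  (h : ℂ) * (pd1 u x + Complex.I * pd2 u x) + (((pd1 ψ x : ℝ) : ℂ) + Complex.I * ((pd2 ψ x : ℝ) : ℂ)) * u x

theorem ContDiffOn.continuousOn_pd {Ω : Set (ℝ × ℝ)} {ψ : ℝ × ℝ → ℝ} (hψ : ContDiffOn ℝ 2 ψ Ω)
    (hΩ : IsOpen Ω) : ContinuousOn (pd1 ψ) Ω ∧ ContinuousOn (pd2 ψ) Ω :=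
  ⟨(ContDiffOn.fderiv_apply_of_isOpen (m := 1) (n := 2) hψ hΩ (by norm_num) (1, 0)).continuousOn,
  (ContDiffOn.fderiv_apply_of_isOpen (m := 1) (n := 2) hψ hΩ (by norm_num) (0, 1)).continuousOn⟩

theorem continuous_twistedDbar {Ω : Set (ℝ × ℝ)} {ψ : ℝ × ℝ → ℝ} {u : ℝ × ℝ → ℂ} (h : ℝ)
    (hΩ : IsOpen Ω) (hψ : ContDiffOn ℝ 2 ψ Ω) (hu : ContDiff ℝ 1 u) (hs : tsupport u ⊆ Ω) :
    Continuous (twistedDbar h ψ u) := by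
  have h1 : Continuous (pd1 u) := (hu.pd1 (m := 0) (by norm_num)).continuous
  have h2 : Continuous (pd2 u) := (hu.pd2 (m := 0) (by norm_num)).continuous
  obtain ⟨g1, g2⟩ := hψ.continuousOn_pd hΩ
  have h3 : Continuous fun x => (((pd1 ψ x : ℝ) : ℂ) + Complex.I * ((pd2 ψ x : ℝ) : ℂ)) * u x := by
    refine ContinuousOn.continuous_mul_of_tsupport_subset hΩ ?_ hu.continuous hs
    fun_prop
  exact (continuous_const.mul (h1.add (continuous_const.mul h2))).add h3

theorem twistedDbar_eq_zero_of_notMem_tsupport {h : ℝ} {ψ : ℝ × ℝ → ℝ} {u : ℝ × ℝ → ℂ}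
    {x : ℝ × ℝ} (hx : x ∉ tsupport u) : twistedDbar h ψ u x = 0 := by
  simp [twistedDbar, pd1_eq_zero_of_notMem_tsupport hx, pd2_eq_zero_of_notMem_tsupport hx,
    image_eq_zero_of_notMem_tsupport hx]

/-- The quadratic form of the spin-down Pauli operator is the square of a first order operator. -/
theorem pauli_form_eq_integral_twistedDbar {Ω : Set (ℝ × ℝ)} {B ψ : ℝ × ℝ → ℝ} {u : ℝ × ℝ → ℂ}
    (h : ℝ) (hΩ : IsOpen Ω) (hψ : ContDiffOn ℝ 2 ψ Ω) (hB : ContinuousOn B Ω)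
    (hlap : ∀ x ∈ Ω, lap ψ x = B x)
    (hu : ContDiff ℝ 2 u) (hc : HasCompactSupport u) (hs : tsupport u ⊆ Ω) :
    (∫ x in Ω, (‖(h : ℂ) * pd1 u x - Complex.I * ((perpGrad ψ x).1 : ℂ) * u x‖ ^ 2
      + ‖(h : ℂ) * pd2 u x - Complex.I * ((perpGrad ψ x).2 : ℂ) * u x‖ ^ 2))
    + (-1) * (h * ∫ x in Ω, B x * ‖u x‖ ^ 2) = ∫ x in Ω, ‖twistedDbar h ψ u x‖ ^ 2 := by
  have h1 : Continuous (pd1 u) := (hu.pd1 (m := 1) (n := 2) (by norm_num)).continuous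
  have h2 : Continuous (pd2 u) := (hu.pd2 (m := 1) (n := 2) (by norm_num)).continuous
  have hu0 := hu.continuous
  obtain ⟨g1, g2⟩ := hψ.continuousOn_pd hΩ
  have hout : ∀ x, x ∉ tsupport u → u x = 0 ∧ pd1 u x = 0 ∧ pd2 u x = 0 := fun x hx =>
    ⟨image_eq_zero_of_notMem_tsupport hx, pd1_eq_zero_of_notMem_tsupport hx,
      pd2_eq_zero_of_notMem_tsupport hx⟩
  set q : ℝ × ℝ → ℝ := fun x =>
    ‖(h : ℂ) * pd1 u x - Complex.I * ((perpGrad ψ x).1 : ℂ) * u x‖ ^ 2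
      + ‖(h : ℂ) * pd2 u x - Complex.I * ((perpGrad ψ x).2 : ℂ) * u x‖ ^ 2 with hq
  set r : ℝ × ℝ → ℝ := fun x => ‖twistedDbar h ψ u x‖ ^ 2 with hr
  set p : ℝ × ℝ → ℝ := fun x => B x * ‖u x‖ ^ 2 with hp
  have hqc : Continuous q := by
    have k1 : Continuous fun x => (Complex.I * ((perpGrad ψ x).1 : ℂ)) * u x := by
      refine ContinuousOn.continuous_mul_of_tsupport_subset hΩ ?_ hu.continuous hs
      simp only [perpGrad]
      fun_prop
    have k2 : Continuous fun x => (Complex.I * ((perpGrad ψ x).2 : ℂ)) * u x := by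
      refine ContinuousOn.continuous_mul_of_tsupport_subset hΩ ?_ hu.continuous hs
      simp only [perpGrad]
      fun_prop
    fun_prop
  have hrc : Continuous r :=
    (continuous_twistedDbar h hΩ hψ (hu.of_le (by norm_num)) hs).norm.pow 2
  have hsq : tsupport (fun x => ‖u x‖ ^ 2) ⊆ tsupport u :=
    closure_mono fun x hx => by simpa using hx
  have hpc : Continuous p := ContinuousOn.continuous_mul_of_tsupport_subset hΩ hB
    (by fun_prop) (hsq.trans hs)
  have hqo : ∀ x, x ∉ tsupport u → q x = 0 := fun x hx => by simp [hq, hout x hx]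
  have hro : ∀ x, x ∉ tsupport u → r x = 0 := fun x hx => by
    simp [hr, twistedDbar_eq_zero_of_notMem_tsupport hx]
  have hpo : ∀ x, x ∉ tsupport u → p x = 0 := fun x hx => by simp [hp, hout x hx]
  have hqi := hqc.integrable_of_hasCompactSupport (μ := volume)
    (HasCompactSupport.intro hc.isCompact hqo)
  have hri := hrc.integrable_of_hasCompactSupport (μ := volume)
    (HasCompactSupport.intro hc.isCompact hro)
  have hpi := hpc.integrable_of_hasCompactSupport (μ := volume)
    (HasCompactSupport.intro hc.isCompact hpo)
  rw [setIntegral_eq_integral_of_forall_compl_eq_zero fun x hx => hqo x fun hx' => hx (hs hx'),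
    setIntegral_eq_integral_of_forall_compl_eq_zero fun x hx => hro x fun hx' => hx (hs hx'),
    setIntegral_eq_integral_of_forall_compl_eq_zero fun x hx => hpo x fun hx' => hx (hs hx')]
  set a : ℝ × ℝ → ℝ := fun x => (u x).re with ha
  set b : ℝ × ℝ → ℝ := fun x => (u x).im with hb
  have hac : ContDiff ℝ 2 a := Complex.reCLM.contDiff.comp hu
  have hbc : ContDiff ℝ 2 b := Complex.imCLM.contDiff.comp hu
  have hao : ∀ x, x ∉ tsupport u → a x = 0 := fun x hx => by simp [ha, hout x hx]
  have hbo : ∀ x, x ∉ tsupport u → b x = 0 := fun x hx => by simp [hb, hout x hx]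
  have hN : ContDiff ℝ 1 fun x => a x ^ 2 + b x ^ 2 :=
    (((hac.pow 2).add (hbc.pow 2)).of_le (by norm_num))
  have hNs : tsupport (fun x => a x ^ 2 + b x ^ 2) ⊆ Ω := by
    refine (closure_minimal (fun x hx => ?_) (isClosed_tsupport u)).trans hs
    by_contra hx'
    simp [hao x hx', hbo x hx'] at hx
  have hψ1 : ContDiffOn ℝ 1 (pd1 ψ) Ω :=
    ContDiffOn.fderiv_apply_of_isOpen (m := 1) (n := 2) hψ hΩ (by norm_num) (1, 0)
  have hψ2 : ContDiffOn ℝ 1 (pd2 ψ) Ω :=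
    ContDiffOn.fderiv_apply_of_isOpen (m := 1) (n := 2) hψ hΩ (by norm_num) (0, 1)
  have hb1 : ContDiff ℝ 1 (pd1 b) := hbc.pd1 (m := 1) (n := 2) (by norm_num)
  have hb2 : ContDiff ℝ 1 (pd2 b) := hbc.pd2 (m := 1) (n := 2) (by norm_num)
  have hF1 : ContDiff ℝ 1 fun x => h * (pd1 ψ x * (a x ^ 2 + b x ^ 2))
      - 2 * h ^ 2 * (a x * pd2 b x) :=
    (contDiff_const.mul (ContDiffOn.contDiff_mul_of_tsupport_subset hΩ hψ1 hN hNs)).sub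
      (contDiff_const.mul ((hac.of_le (by norm_num)).mul hb2))
  have hF2 : ContDiff ℝ 1 fun x => h * (pd2 ψ x * (a x ^ 2 + b x ^ 2))
      + 2 * h ^ 2 * (a x * pd1 b x) :=
    (contDiff_const.mul (ContDiffOn.contDiff_mul_of_tsupport_subset hΩ hψ2 hN hNs)).add
      (contDiff_const.mul ((hac.of_le (by norm_num)).mul hb1))
  set F1 : ℝ × ℝ → ℝ := fun x => h * (pd1 ψ x * (a x ^ 2 + b x ^ 2))
      - 2 * h ^ 2 * (a x * pd2 b x) with hF1d
  set F2 : ℝ × ℝ → ℝ := fun x => h * (pd2 ψ x * (a x ^ 2 + b x ^ 2))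
      + 2 * h ^ 2 * (a x * pd1 b x) with hF2d
  have hF1s : tsupport F1 ⊆ tsupport u := by
    refine closure_minimal (fun x hx => ?_) (isClosed_tsupport u)
    by_contra hx'
    simp [hF1d, hao x hx', hbo x hx'] at hx
  have hF2s : tsupport F2 ⊆ tsupport u := by
    refine closure_minimal (fun x hx => ?_) (isClosed_tsupport u)
    by_contra hx'
    simp [hF2d, hao x hx', hbo x hx'] at hx
  have hF1c : HasCompactSupport F1 := hc.of_isClosed_subset (isClosed_tsupport _) hF1s
  have hF2c : HasCompactSupport F2 := hc.of_isClosed_subset (isClosed_tsupport _) hF2s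
  have hi1 : Integrable (pd1 F1) := ((hF1.pd1 (m := 0) (by norm_num)).continuous
    ).integrable_of_hasCompactSupport (hF1c.fderiv_apply ℝ _)
  have hi2 : Integrable (pd2 F2) := ((hF2.pd2 (m := 0) (by norm_num)).continuous
    ).integrable_of_hasCompactSupport (hF2c.fderiv_apply ℝ _)
  have z1 : ∫ x, pd1 F1 x = 0 := integral_fderiv_eq_zero_of_hasCompactSupport hF1 hF1c _
  have z2 : ∫ x, pd2 F2 x = 0 := integral_fderiv_eq_zero_of_hasCompactSupport hF2 hF2c _
  have key : ∀ x, r x = q x + (-h) * p x + (pd1 F1 x + pd2 F2 x) := by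
    intro x
    by_cases hx : x ∈ tsupport u
    swap
    · rw [hqo x hx, hro x hx, hpo x hx,
        pd1_eq_zero_of_notMem_tsupport fun hx' => hx (hF1s hx'),
        pd2_eq_zero_of_notMem_tsupport fun hx' => hx (hF2s hx')]
      simp
    have hxΩ := hs hx
    have hud : DifferentiableAt ℝ u x := hu.differentiable (by norm_num) x
    have dψ1 : DifferentiableAt ℝ (pd1 ψ) x :=
      (hψ1.contDiffAt (hΩ.mem_nhds hxΩ)).differentiableAt (by norm_num)
    have dψ2 : DifferentiableAt ℝ (pd2 ψ) x :=
      (hψ2.contDiffAt (hΩ.mem_nhds hxΩ)).differentiableAt (by norm_num)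
    have da : DifferentiableAt ℝ a x := hac.differentiable (by norm_num) x
    have db : DifferentiableAt ℝ b x := hbc.differentiable (by norm_num) x
    have db1 : DifferentiableAt ℝ (pd1 b) x := hb1.differentiable (by norm_num) x
    have db2 : DifferentiableAt ℝ (pd2 b) x := hb2.differentiable (by norm_num) x
    have e1 := ((dψ1.hasFDerivAt.mul ((da.hasFDerivAt.pow 2).add (db.hasFDerivAt.pow 2))).const_mul
      h).sub ((da.hasFDerivAt.mul db2.hasFDerivAt).const_mul (2 * h ^ 2))
    have e2 := ((dψ2.hasFDerivAt.mul ((da.hasFDerivAt.pow 2).add (db.hasFDerivAt.pow 2))).const_mul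
      h).add ((da.hasFDerivAt.mul db1.hasFDerivAt).const_mul (2 * h ^ 2))
    have f1 : pd1 F1 x = _ := congrArg (fun L => L (1, 0)) e1.fderiv
    have f2 : pd2 F2 x = _ := congrArg (fun L => L (0, 1)) e2.fderiv
    have hsym : fderiv ℝ (pd2 b) x (1, 0) = fderiv ℝ (pd1 b) x (0, 1) :=
      fderiv_fderiv_apply_comm hbc x (0, 1) (1, 0)
    have hlapx := hlap x hxΩ
    have u1 : pd1 u x = (fderiv ℝ a x (1, 0) : ℂ) + Complex.I * (fderiv ℝ b x (1, 0) : ℂ) :=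
      fderiv_apply_eq_re_add_im hud _
    have u2 : pd2 u x = (fderiv ℝ a x (0, 1) : ℂ) + Complex.I * (fderiv ℝ b x (0, 1) : ℂ) :=
      fderiv_apply_eq_re_add_im hud _
    have u0 : u x = (a x : ℂ) + Complex.I * (b x : ℂ) := by
      apply Complex.ext <;> simp [ha, hb]
    have hl : fderiv ℝ (pd1 ψ) x (1, 0) + fderiv ℝ (pd2 ψ) x (0, 1) = B x := hlapx
    have hb1' : pd1 b x = fderiv ℝ b x (1, 0) := rfl
    have hb2' : pd2 b x = fderiv ℝ b x (0, 1) := rfl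
    rw [f1, f2]
    simp only [hr, hq, hp, twistedDbar, perpGrad, u1, u2, u0, ← hl, Complex.sq_norm,
      Complex.normSq_apply]
    simp [hsym, hb1', hb2']
    ring
  have hint : ∫ x, r x = (∫ x, q x) + (-h) * (∫ x, p x) := by
    calc ∫ x, r x = ∫ x, (q x + (-h) * p x + (pd1 F1 x + pd2 F2 x)) :=
          integral_congr_ae (Eventually.of_forall key)
      _ = (∫ x, (q x + (-h) * p x)) + ∫ x, (pd1 F1 x + pd2 F2 x) :=
          integral_add (hqi.add (hpi.const_mul _)) (hi1.add hi2)
      _ = _ := by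
          rw [integral_add hqi (hpi.const_mul _), integral_add hi1 hi2, z1, z2,
            integral_const_mul]
          ring
  rw [hint]
  ring

/-- Poincaré's inequality in a strip of width `2R`. -/
theorem integral_norm_sq_le_integral_norm_pd1_sq {u : ℝ × ℝ → ℂ} {R : ℝ}
    (hu : ContDiff ℝ 1 u) (hc : HasCompactSupport u) (hR : ∀ x ∈ tsupport u, |x.1| ≤ R) :
    ∫ x, ‖u x‖ ^ 2 ≤ 4 * R ^ 2 * ∫ x, ‖pd1 u x‖ ^ 2 := by
  have hu0 := hu.continuous
  have h1 : Continuous (pd1 u) := (hu.pd1 (m := 0) (n := 1) (by norm_num)).continuous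
  set a : ℝ × ℝ → ℝ := fun x => (u x).re with ha
  set b : ℝ × ℝ → ℝ := fun x => (u x).im with hb
  have hac : ContDiff ℝ 1 a := Complex.reCLM.contDiff.comp hu
  have hbc : ContDiff ℝ 1 b := Complex.imCLM.contDiff.comp hu
  have hF : ContDiff ℝ 1 fun x : ℝ × ℝ => x.1 * (a x ^ 2 + b x ^ 2) := by fun_prop
  set F : ℝ × ℝ → ℝ := fun x => x.1 * (a x ^ 2 + b x ^ 2) with hFd
  have hFs : tsupport F ⊆ tsupport u := by
    refine closure_minimal (fun x hx => ?_) (isClosed_tsupport u)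
    by_contra hx'
    simp [hFd, ha, hb, image_eq_zero_of_notMem_tsupport hx'] at hx
  have hFc : HasCompactSupport F := hc.of_isClosed_subset (isClosed_tsupport _) hFs
  have hi : Integrable (pd1 F) := ((hF.pd1 (m := 0) (by norm_num)).continuous
    ).integrable_of_hasCompactSupport (hFc.fderiv_apply ℝ _)
  have z : ∫ x, pd1 F x = 0 := integral_fderiv_eq_zero_of_hasCompactSupport hF hFc _
  have hui : Integrable fun x => ‖u x‖ ^ 2 :=
    Continuous.integrable_of_hasCompactSupport (by fun_prop)
      (HasCompactSupport.intro hc.isCompact fun x hx => by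
        simp [image_eq_zero_of_notMem_tsupport hx])
  have hu1i : Integrable fun x => ‖pd1 u x‖ ^ 2 :=
    Continuous.integrable_of_hasCompactSupport (by fun_prop)
      (HasCompactSupport.intro hc.isCompact fun x hx => by
        simp [pd1_eq_zero_of_notMem_tsupport hx])
  have key : ∀ x, ‖u x‖ ^ 2 ≤ 2 * pd1 F x + 4 * R ^ 2 * ‖pd1 u x‖ ^ 2 := by
    intro x
    by_cases hx : x ∈ tsupport u
    swap
    · simp [image_eq_zero_of_notMem_tsupport hx, pd1_eq_zero_of_notMem_tsupport hx,
        pd1_eq_zero_of_notMem_tsupport fun hx' => hx (hFs hx')]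
    have da : DifferentiableAt ℝ a x := hac.differentiable (by norm_num) x
    have db : DifferentiableAt ℝ b x := hbc.differentiable (by norm_num) x
    have e := (hasFDerivAt_fst (𝕜 := ℝ) (p := x)).mul
      ((da.hasFDerivAt.pow 2).add (db.hasFDerivAt.pow 2))
    have f : pd1 F x = _ := congrArg (fun L => L (1, 0)) e.fderiv
    have u1 : pd1 u x = (fderiv ℝ a x (1, 0) : ℂ) + Complex.I * (fderiv ℝ b x (1, 0) : ℂ) :=
      fderiv_apply_eq_re_add_im (hu.differentiable (by norm_num) x) _
    have u0 : u x = (a x : ℂ) + Complex.I * (b x : ℂ) := by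
      apply Complex.ext <;> simp [ha, hb]
    have hx1 : x.1 ^ 2 ≤ R ^ 2 := sq_le_sq' (abs_le.1 (hR x hx)).1 (abs_le.1 (hR x hx)).2
    rw [f]
    simp only [u1, u0, Complex.sq_norm, Complex.normSq_apply]
    simp
    set s := fderiv ℝ a x (1, 0)
    set t := fderiv ℝ b x (1, 0)
    nlinarith [sq_nonneg (a x + 2 * x.1 * s), sq_nonneg (b x + 2 * x.1 * t),
      mul_nonneg (sub_nonneg.2 hx1) (sq_nonneg s), mul_nonneg (sub_nonneg.2 hx1) (sq_nonneg t)]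
  calc ∫ x, ‖u x‖ ^ 2 ≤ ∫ x, (2 * pd1 F x + 4 * R ^ 2 * ‖pd1 u x‖ ^ 2) :=
        integral_mono hui ((hi.const_mul _).add (hu1i.const_mul _)) key
    _ = _ := by
        rw [integral_add (hi.const_mul _) (hu1i.const_mul _), integral_const_mul,
          integral_const_mul, z]
        ring

theorem twistedDbar_exp_mul {h : ℝ} (hh : h ≠ 0) {ψ : ℝ × ℝ → ℝ} {w : ℝ × ℝ → ℂ} {x : ℝ × ℝ}
    (hψ : DifferentiableAt ℝ ψ x) (hw : DifferentiableAt ℝ w x) :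
    twistedDbar h ψ (fun y => ((Real.exp (-ψ y / h) : ℝ) : ℂ) * w y) x
      = (h : ℂ) * ((Real.exp (-ψ x / h) : ℝ) : ℂ) * (pd1 w x + Complex.I * pd2 w x) := by
  have he : HasFDerivAt (fun y => Real.exp (-ψ y / h))
      (Real.exp (-ψ x / h) • (h⁻¹ • (-fderiv ℝ ψ x))) x := by
    have := (hψ.hasFDerivAt.neg.const_mul h⁻¹).exp
    simpa [div_eq_inv_mul] using this
  have hE : HasFDerivAt (fun y => ((Real.exp (-ψ y / h) : ℝ) : ℂ))
      (Complex.ofRealCLM ∘L (Real.exp (-ψ x / h) • (h⁻¹ • (-fderiv ℝ ψ x)))) x :=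
    Complex.ofRealCLM.hasFDerivAt.comp x he
  have hm := (hE.mul hw.hasFDerivAt).fderiv
  have m1 : pd1 (fun y => ((Real.exp (-ψ y / h) : ℝ) : ℂ) * w y) x = _ :=
    congrArg (fun L => L (1, 0)) hm
  have m2 : pd2 (fun y => ((Real.exp (-ψ y / h) : ℝ) : ℂ) * w y) x = _ :=
    congrArg (fun L => L (0, 1)) hm
  have hhc : (h : ℂ) ≠ 0 := by exact_mod_cast hh
  rw [twistedDbar, m1, m2]
  simp [pd1, pd2]
  field_simp
  ring

theorem ContDiffOn.ofReal_exp_div {Ω : Set (ℝ × ℝ)} {ψ : ℝ × ℝ → ℝ} (hψ : ContDiffOn ℝ 2 ψ Ω)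
    (h : ℝ) : ContDiffOn ℝ 2 (fun y => ((Real.exp (ψ y / h) : ℝ) : ℂ)) Ω :=
  Complex.ofRealCLM.contDiff.comp_contDiffOn (hψ.div_const h).exp

theorem integral_norm_sq_le_integral_twistedDbar {Ω : Set (ℝ × ℝ)} {ψ : ℝ × ℝ → ℝ}
    {u : ℝ × ℝ → ℂ} {h R m M : ℝ} (hh : 0 < h) (hΩ : IsOpen Ω) (hψ : ContDiffOn ℝ 2 ψ Ω)
    (hR : ∀ x ∈ Ω, |x.1| ≤ R) (hm : ∀ x ∈ Ω, m ≤ ψ x) (hM : ∀ x ∈ Ω, ψ x ≤ M)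
    (hu : ContDiff ℝ 2 u) (hc : HasCompactSupport u) (hs : tsupport u ⊆ Ω) :
    h ^ 2 * Real.exp (-2 * (M - m) / h) * ∫ x in Ω, ‖u x‖ ^ 2
      ≤ 4 * R ^ 2 * ∫ x in Ω, ‖twistedDbar h ψ u x‖ ^ 2 := by
  set v : ℝ × ℝ → ℂ := fun y => ((Real.exp (ψ y / h) : ℝ) : ℂ) * u y with hv
  have hvc : ContDiff ℝ 2 v :=
    ContDiffOn.contDiff_mul_of_tsupport_subset (n := 2) hΩ (hψ.ofReal_exp_div h) hu hs
  have hvs : tsupport v ⊆ tsupport u := closure_mono (Function.support_mul_subset_right _ _)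
  have hvcs : HasCompactSupport v := hc.of_isClosed_subset (isClosed_tsupport _) hvs
  have huv : u = fun y => ((Real.exp (-ψ y / h) : ℝ) : ℂ) * v y := by
    ext y
    rw [hv, ← mul_assoc, ← Complex.ofReal_mul, ← Real.exp_add]
    simp [neg_div]
  have hv0 := hvc.continuous
  have hu0 := hu.continuous
  have h1 : Continuous (pd1 v) := (hvc.pd1 (m := 1) (n := 2) (by norm_num)).continuous
  have h2 : Continuous (pd2 v) := (hvc.pd2 (m := 1) (n := 2) (by norm_num)).continuous
  have hint : ∀ {f : ℝ × ℝ → ℂ}, Continuous f → (∀ x, x ∉ tsupport u → f x = 0) →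
      Integrable (fun x => ‖f x‖ ^ 2) := fun hf h0 =>
    Continuous.integrable_of_hasCompactSupport (by fun_prop)
      (HasCompactSupport.intro hc.isCompact fun x hx => by simp [h0 x hx])
  have hui := hint hu0 fun x hx => image_eq_zero_of_notMem_tsupport hx
  have hvi := hint hv0 fun x hx => image_eq_zero_of_notMem_tsupport fun hx' => hx (hvs hx')
  have h1i := hint h1 fun x hx => pd1_eq_zero_of_notMem_tsupport fun hx' => hx (hvs hx')
  have h2i := hint h2 fun x hx => pd2_eq_zero_of_notMem_tsupport fun hx' => hx (hvs hx')
  have hti := hint (continuous_twistedDbar h hΩ hψ (hu.of_le (by norm_num)) hs) fun x hx =>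
    twistedDbar_eq_zero_of_notMem_tsupport hx
  have hvti := hint (continuous_twistedDbar 1 hΩ (contDiffOn_const (c := (0 : ℝ)))
    (hvc.of_le (by norm_num)) (hvs.trans hs)) fun x hx =>
    twistedDbar_eq_zero_of_notMem_tsupport fun hx' => hx (hvs hx')
  have hform := pauli_form_eq_integral_twistedDbar (Ω := Ω) (B := fun _ => 0) (ψ := fun _ => 0) 1 hΩ
    contDiffOn_const continuousOn_const (fun x _ => by
      simp [lap, show pd1 (fun _ : ℝ × ℝ => (0 : ℝ)) = fun _ => 0 by ext; simp [pd1],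
        show pd2 (fun _ : ℝ × ℝ => (0 : ℝ)) = fun _ => 0 by ext; simp [pd2]])
    hvc hvcs (hvs.trans hs)
  have hgrad : ∫ x in Ω, ‖pd1 v x‖ ^ 2 ≤ ∫ x in Ω, ‖twistedDbar 1 (fun _ => 0) v x‖ ^ 2 := by
    rw [← hform]
    have e1 : pd1 (fun _ : ℝ × ℝ => (0 : ℝ)) = fun _ => 0 := by ext; simp [pd1]
    have e2 : pd2 (fun _ : ℝ × ℝ => (0 : ℝ)) = fun _ => 0 := by ext; simp [pd2]
    simp only [perpGrad, e1, e2]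
    simp only [neg_zero, Complex.ofReal_zero, mul_zero, zero_mul, sub_zero, Complex.ofReal_one,
      one_mul, integral_zero, add_zero]
    exact integral_mono h1i.integrableOn (h1i.integrableOn.add h2i.integrableOn)
      fun x => le_add_of_nonneg_right (by positivity)
  have hpoin : ∫ x in Ω, ‖v x‖ ^ 2 ≤ 4 * R ^ 2 * ∫ x in Ω, ‖pd1 v x‖ ^ 2 := by
    rw [setIntegral_eq_integral_of_forall_compl_eq_zero fun x hx => by
        simp [image_eq_zero_of_notMem_tsupport fun hx' => hx (hs (hvs hx'))],
      setIntegral_eq_integral_of_forall_compl_eq_zero fun x hx => by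
        simp [pd1_eq_zero_of_notMem_tsupport fun hx' => hx (hs (hvs hx'))]]
    exact integral_norm_sq_le_integral_norm_pd1_sq (hvc.of_le (by norm_num)) hvcs
      fun x hx => hR x (hs (hvs hx))
  have hlow : Real.exp (2 * m / h) * ∫ x in Ω, ‖u x‖ ^ 2 ≤ ∫ x in Ω, ‖v x‖ ^ 2 := by
    rw [← integral_const_mul]
    refine setIntegral_mono_on (hui.integrableOn.const_mul _) hvi.integrableOn hΩ.measurableSet
      fun x hx => ?_
    simp only [hv, norm_mul, mul_pow, Complex.norm_real, Real.norm_eq_abs, Real.abs_exp,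
      ← Real.exp_nat_mul]
    gcongr
    push_cast
    rw [mul_div_assoc]
    gcongr
    exact hm x hx
  have hupp : h ^ 2 * ∫ x in Ω, ‖twistedDbar 1 (fun _ => 0) v x‖ ^ 2
      ≤ Real.exp (2 * M / h) * ∫ x in Ω, ‖twistedDbar h ψ u x‖ ^ 2 := by
    rw [← integral_const_mul, ← integral_const_mul]
    refine setIntegral_mono_on (hvti.integrableOn.const_mul _) (hti.integrableOn.const_mul _)
      hΩ.measurableSet fun x hx => ?_
    have htw : twistedDbar h ψ u x = (h : ℂ) * ((Real.exp (-ψ x / h) : ℝ) : ℂ) *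
        (pd1 v x + Complex.I * pd2 v x) := by
      rw [huv]
      exact twistedDbar_exp_mul hh.ne'
        ((hψ.contDiffAt (hΩ.mem_nhds hx)).differentiableAt (by norm_num))
        (hvc.differentiable (by norm_num) x)
    have hvt : twistedDbar 1 (fun _ => 0) v x = pd1 v x + Complex.I * pd2 v x := by
      simp [twistedDbar, pd1, pd2]
    rw [htw, hvt, norm_mul, norm_mul]
    simp only [mul_pow, Complex.norm_real, Real.norm_eq_abs, Real.abs_exp, sq_abs,
      ← Real.exp_nat_mul]
    have : 1 ≤ Real.exp (2 * M / h) * Real.exp ((2 : ℕ) * (-ψ x / h)) := by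
      rw [← Real.exp_add]
      apply Real.one_le_exp
      have := hM x hx
      rw [show 2 * M / h + (2 : ℕ) * (-ψ x / h) = 2 * (M - ψ x) / h by push_cast; ring]
      exact div_nonneg (by linarith) hh.le
    calc h ^ 2 * ‖pd1 v x + Complex.I * pd2 v x‖ ^ 2
        ≤ (Real.exp (2 * M / h) * Real.exp ((2 : ℕ) * (-ψ x / h))) *
          (h ^ 2 * ‖pd1 v x + Complex.I * pd2 v x‖ ^ 2) :=
          le_mul_of_one_le_left (by positivity) this
      _ = _ := by ring
  have hexp : Real.exp (-2 * (M - m) / h) = Real.exp (2 * m / h) * Real.exp (-(2 * M / h)) := by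
    rw [← Real.exp_add]
    congr 1
    ring
  calc h ^ 2 * Real.exp (-2 * (M - m) / h) * ∫ x in Ω, ‖u x‖ ^ 2
      = h ^ 2 * Real.exp (-(2 * M / h)) * (Real.exp (2 * m / h) * ∫ x in Ω, ‖u x‖ ^ 2) := by
        rw [hexp]
        ring
    _ ≤ h ^ 2 * Real.exp (-(2 * M / h)) *
        (4 * R ^ 2 * ∫ x in Ω, ‖twistedDbar 1 (fun _ => 0) v x‖ ^ 2) := by
        refine mul_le_mul_of_nonneg_left (hlow.trans (hpoin.trans ?_)) (by positivity)
        gcongr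
    _ = 4 * R ^ 2 * Real.exp (-(2 * M / h)) *
        (h ^ 2 * ∫ x in Ω, ‖twistedDbar 1 (fun _ => 0) v x‖ ^ 2) := by ring
    _ ≤ 4 * R ^ 2 * Real.exp (-(2 * M / h)) *
        (Real.exp (2 * M / h) * ∫ x in Ω, ‖twistedDbar h ψ u x‖ ^ 2) := by gcongr
    _ = _ := by
        rw [Real.exp_neg]
        field_simp

open scoped Convolution in
theorem exists_contDiff_approx {f : ℝ × ℝ → ℂ} {Ω : Set (ℝ × ℝ)} (hΩ : IsOpen Ω)
    (hf : ContDiff ℝ 1 f) (hc : HasCompactSupport f) (hs : tsupport f ⊆ Ω) :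
    ∃ K, IsCompact K ∧ K ⊆ Ω ∧ tsupport f ⊆ K ∧ ∀ ε > 0, ∃ w : ℝ × ℝ → ℂ,
      ContDiff ℝ (⊤ : ℕ∞) w ∧ tsupport w ⊆ K ∧ (∀ x, ‖w x - f x‖ ≤ ε) ∧
      (∀ x, ‖pd1 w x - pd1 f x‖ ≤ ε) ∧ ∀ x, ‖pd2 w x - pd2 f x‖ ≤ ε := by
  obtain ⟨δ, hδ, hδΩ⟩ := hc.isCompact.exists_cthickening_subset_open hΩ hs
  refine ⟨Metric.cthickening δ (tsupport f), hc.isCompact.cthickening, hδΩ,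
    Metric.self_subset_cthickening _, fun ε hε => ?_⟩
  have hd1 : Continuous (pd1 f) := (hf.pd1 (m := 0) (n := 1) (by norm_num)).continuous
  have hd2 : Continuous (pd2 f) := (hf.pd2 (m := 0) (n := 1) (by norm_num)).continuous
  obtain ⟨r0, hr0, h0⟩ := Metric.uniformContinuous_iff.1
    (hc.uniformContinuous_of_continuous hf.continuous) ε hε
  obtain ⟨r1, hr1, h1⟩ := Metric.uniformContinuous_iff.1
    ((hc.fderiv_apply ℝ (1, 0)).uniformContinuous_of_continuous hd1) ε hε
  obtain ⟨r2, hr2, h2⟩ := Metric.uniformContinuous_iff.1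
    ((hc.fderiv_apply ℝ (0, 1)).uniformContinuous_of_continuous hd2) ε hε
  set r := min δ (min r0 (min r1 r2)) with hr
  have hrpos : 0 < r := by positivity
  let φ : ContDiffBump (0 : ℝ × ℝ) := ⟨r / 2, r, by positivity, by linarith⟩
  have hloc : LocallyIntegrable (φ.normed (volume : Measure (ℝ × ℝ))) :=
    φ.continuous_normed.locallyIntegrable
  set L := ContinuousLinearMap.lsmul ℝ ℝ (E := ℂ) with hL
  set w : ℝ × ℝ → ℂ := φ.normed volume ⋆[L, volume] f with hw
  have hpd : ∀ v x, fderiv ℝ w x v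
      = (φ.normed volume ⋆[L, volume] fun y => fderiv ℝ f y v) x := by
    intro v x
    rw [(hc.hasFDerivAt_convolution_right L hloc hf x).fderiv]
    exact convolution_precompR_apply L hloc (hc.fderiv ℝ) (hf.continuous_fderiv (by simp)) x v
  refine ⟨w, φ.hasCompactSupport_normed.contDiff_convolution_left L φ.contDiff_normed
    hf.continuous.locallyIntegrable, ?_, ?_, ?_, ?_⟩
  · refine closure_minimal (fun x hx => ?_) Metric.isClosed_cthickening
    obtain ⟨a, ha, b, hb, rfl⟩ := support_convolution_subset L hx
    rw [φ.support_normed_eq, mem_ball_zero_iff] at ha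
    refine Metric.mem_cthickening_of_dist_le _ b δ _ (subset_closure hb) ?_
    rw [dist_eq_norm, add_sub_cancel_right]
    exact ha.le.trans (min_le_left _ _)
  · intro x
    rw [← dist_eq_norm]
    refine φ.dist_normed_convolution_le hf.continuous.aestronglyMeasurable fun y hy => ?_
    exact (h0 ((Metric.mem_ball.1 hy).trans_le (by simp [φ, r]))).le
  · intro x
    rw [← dist_eq_norm]
    simp only [pd1, hpd]
    refine φ.dist_normed_convolution_le hd1.aestronglyMeasurable fun y hy => ?_
    exact (h1 ((Metric.mem_ball.1 hy).trans_le (by simp [φ, r]))).le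
  · intro x
    rw [← dist_eq_norm]
    simp only [pd2, hpd]
    refine φ.dist_normed_convolution_le hd2.aestronglyMeasurable fun y hy => ?_
    exact (h2 ((Metric.mem_ball.1 hy).trans_le (by simp [φ, r]))).le

theorem integral_norm_sq_pos_of_isTestFun {Ω : Set (ℝ × ℝ)} {u : ℝ × ℝ → ℂ}
    (hu : IsTestFun Ω u) : 0 < ∫ x in Ω, ‖u x‖ ^ 2 := by
  obtain ⟨hd, hc, hs, h0⟩ := hu
  have hu0 := hd.continuous
  obtain ⟨x, hx⟩ := Function.ne_iff.1 h0
  rw [setIntegral_eq_integral_of_forall_compl_eq_zero fun x hx => by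
    simp [image_eq_zero_of_notMem_tsupport fun hx' => hx (hs hx')]]
  refine Continuous.integral_pos_of_hasCompactSupport_nonneg_nonzero (x := x) (by fun_prop)
    (HasCompactSupport.intro hc.isCompact fun x hx => by
      simp [image_eq_zero_of_notMem_tsupport hx]) (fun x => by positivity) ?_
  simpa using hx

theorem exists_isTestFun {Ω : Set (ℝ × ℝ)} (hΩ : IsOpen Ω) (hne : Ω.Nonempty) :
    ∃ u, IsTestFun Ω u := by
  obtain ⟨x, hx⟩ := hne
  obtain ⟨f, hfs, hfc, hfd, -, hfx⟩ := exists_contDiff_tsupport_subset (n := ⊤)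
    (hΩ.mem_nhds hx)
  have hsub : tsupport (fun y => (f y : ℂ)) ⊆ tsupport f :=
    closure_mono fun y hy => by simpa using hy
  refine ⟨fun y => (f y : ℂ), Complex.ofRealCLM.contDiff.comp hfd,
    hfc.of_isClosed_subset (isClosed_tsupport _) hsub, hsub.trans hfs, fun h => ?_⟩
  have := congrFun h x
  simp [hfx] at this

section

variable {Ω : Set (ℝ × ℝ)} {B ψ : ℝ × ℝ → ℝ}

theorem pauliRayleigh_eq_twistedDbar {u : ℝ × ℝ → ℂ} (h : ℝ) (hR : AssumptionR Ω B)
    (hψ : IsScalarPotential Ω B ψ) (hu : IsTestFun Ω u) :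
    pauliRayleigh (-1) h (perpGrad ψ) B Ω u
      = (∫ x in Ω, ‖twistedDbar h ψ u x‖ ^ 2) / ∫ x in Ω, ‖u x‖ ^ 2 := by
  rw [pauliRayleigh, pauli_form_eq_integral_twistedDbar h hR.isOpen hψ.c2
    (hR.fieldCont.mono subset_closure) hψ.lap_eq (contDiff_infty.1 hu.1 2)
    hu.2.1 hu.2.2.1]

theorem lambdaMinusD_mul_le_of_isTestFun {u : ℝ × ℝ → ℂ} (h : ℝ) (hR : AssumptionR Ω B)
    (hψ : IsScalarPotential Ω B ψ) (hu : IsTestFun Ω u) :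
    lambdaMinusD h (perpGrad ψ) B Ω * ∫ x in Ω, ‖u x‖ ^ 2
      ≤ ∫ x in Ω, ‖twistedDbar h ψ u x‖ ^ 2 := by
  rw [← le_div_iff₀ (integral_norm_sq_pos_of_isTestFun hu),
    ← pauliRayleigh_eq_twistedDbar h hR hψ hu]
  refine csInf_le ⟨0, ?_⟩ ⟨u, hu, rfl⟩
  rintro _ ⟨v, hv, rfl⟩
  rw [pauliRayleigh_eq_twistedDbar h hR hψ hv]
  positivity

theorem le_lambdaMinusD {h R m M : ℝ} (hh : 0 < h) (hR : AssumptionR Ω B)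
    (hψ : IsScalarPotential Ω B ψ) (hne : Ω.Nonempty) (hRpos : 0 < R)
    (hΩR : ∀ x ∈ Ω, |x.1| ≤ R) (hm : ∀ x ∈ Ω, m ≤ ψ x) (hM : ∀ x ∈ Ω, ψ x ≤ M) :
    h ^ 2 * Real.exp (-2 * (M - m) / h) / (4 * R ^ 2) ≤ lambdaMinusD h (perpGrad ψ) B Ω := by
  obtain ⟨u₀, hu₀⟩ := exists_isTestFun hR.isOpen hne
  refine le_csInf ⟨_, u₀, hu₀, rfl⟩ ?_
  rintro _ ⟨u, hu, rfl⟩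
  rw [pauliRayleigh_eq_twistedDbar h hR hψ hu, div_le_div_iff₀ (by positivity)
    (integral_norm_sq_pos_of_isTestFun hu), mul_comm (∫ x in Ω, ‖twistedDbar h ψ u x‖ ^ 2)]
  exact integral_norm_sq_le_integral_twistedDbar hh hR.isOpen hψ.c2 hΩR hm hM
    (contDiff_infty.1 hu.1 2) hu.2.1 hu.2.2.1

theorem lambdaMinusD_mul_le {u : ℝ × ℝ → ℂ} (h : ℝ) (hR : AssumptionR Ω B)
    (hψ : IsScalarPotential Ω B ψ) (hu : ContDiff ℝ 1 u) (hc : HasCompactSupport u)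
    (hs : tsupport u ⊆ Ω) :
    lambdaMinusD h (perpGrad ψ) B Ω * ∫ x in Ω, ‖u x‖ ^ 2
      ≤ ∫ x in Ω, ‖twistedDbar h ψ u x‖ ^ 2 := by
  obtain ⟨K, hK, hKΩ, huK, hw⟩ := exists_contDiff_approx hR.isOpen hu hc hs
  choose w hwd hwK hw0 hw1 hw2 using fun n : ℕ => hw (1 / (n + 1)) Nat.one_div_pos_of_nat
  have hlim : ∀ {a : ℕ → ℂ} {b : ℂ}, (∀ n : ℕ, ‖a n - b‖ ≤ 1 / (n + 1)) →
      Tendsto a atTop (𝓝 b) := fun hab => tendsto_iff_norm_sub_tendsto_zero.2 <|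
    squeeze_zero (fun n => norm_nonneg _) hab tendsto_one_div_add_atTop_nhds_zero_nat
  have t0 : ∀ x, Tendsto (fun n => w n x) atTop (𝓝 (u x)) := fun x => hlim fun n => hw0 n x
  have t1 : ∀ x, Tendsto (fun n => pd1 (w n) x) atTop (𝓝 (pd1 u x)) :=
    fun x => hlim fun n => hw1 n x
  have t2 : ∀ x, Tendsto (fun n => pd2 (w n) x) atTop (𝓝 (pd2 u x)) :=
    fun x => hlim fun n => hw2 n x
  have tt : ∀ x, Tendsto (fun n => twistedDbar h ψ (w n) x) atTop (𝓝 (twistedDbar h ψ u x)) :=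
    fun x => (((t1 x).add ((t2 x).const_mul _)).const_mul _).add ((t0 x).const_mul _)
  have hd1 : Continuous (pd1 u) := (hu.pd1 (m := 0) (n := 1) (by norm_num)).continuous
  have hd2 : Continuous (pd2 u) := (hu.pd2 (m := 0) (n := 1) (by norm_num)).continuous
  obtain ⟨g1, g2⟩ := hψ.c2.continuousOn_pd hR.isOpen
  obtain ⟨C0, hC0⟩ := hK.exists_bound_of_continuousOn hu.continuous.continuousOn
  obtain ⟨C1, hC1⟩ := hK.exists_bound_of_continuousOn hd1.continuousOn
  obtain ⟨C2, hC2⟩ := hK.exists_bound_of_continuousOn hd2.continuousOn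
  obtain ⟨G, hG⟩ := hK.exists_bound_of_continuousOn (f := fun x =>
    ((pd1 ψ x : ℝ) : ℂ) + Complex.I * ((pd2 ψ x : ℝ) : ℂ)) (by
      have := g1.mono hKΩ
      have := g2.mono hKΩ
      fun_prop)
  have hbd : ∀ {a b : ℂ} {n : ℕ} {C : ℝ}, ‖a - b‖ ≤ 1 / (n + 1) → ‖b‖ ≤ C → ‖a‖ ≤ C + 1 := by
    intro a b n C hab hb
    have hn : (1 : ℝ) / (n + 1) ≤ 1 := by
      rw [div_le_one (by positivity)]
      simp
    calc ‖a‖ = ‖b + (a - b)‖ := by simp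
      _ ≤ ‖b‖ + ‖a - b‖ := norm_add_le _ _
      _ ≤ C + 1 := by linarith
  set T : ℝ := |h| * (C1 + 1 + (C2 + 1)) + G * (C0 + 1) with hT
  have hbw : ∀ n x, ‖‖w n x‖ ^ 2‖ ≤ K.indicator (fun _ => (C0 + 1) ^ 2) x := by
    intro n x
    by_cases hx : x ∈ K
    · rw [indicator_of_mem hx, norm_pow, norm_norm]
      gcongr
      exact hbd (hw0 n x) (hC0 x hx)
    · simp [indicator_of_notMem hx, image_eq_zero_of_notMem_tsupport fun hx' => hx (hwK n hx')]
  have hbt : ∀ n x, ‖‖twistedDbar h ψ (w n) x‖ ^ 2‖ ≤ K.indicator (fun _ => T ^ 2) x := by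
    intro n x
    by_cases hx : x ∈ K
    · rw [indicator_of_mem hx, norm_pow, norm_norm]
      gcongr
      have i1 := hbd (hw1 n x) (hC1 x hx)
      have i2 := hbd (hw2 n x) (hC2 x hx)
      have i0 := hbd (hw0 n x) (hC0 x hx)
      have hGx := hG x hx
      refine (norm_add_le _ _).trans (add_le_add ?_ ?_)
      · rw [norm_mul, Complex.norm_real, Real.norm_eq_abs]
        gcongr
        refine (norm_add_le _ _).trans (add_le_add i1 ?_)
        simpa using i2
      · rw [norm_mul]
        exact mul_le_mul hGx i0 (norm_nonneg _) ((norm_nonneg _).trans hGx)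
    · simp [indicator_of_notMem hx,
        twistedDbar_eq_zero_of_notMem_tsupport fun hx' => hx (hwK n hx')]
  have hKi : ∀ c : ℝ, Integrable (K.indicator fun _ => c) (volume.restrict Ω) := fun c =>
    ((integrable_indicator_iff hK.measurableSet).2
      (integrableOn_const hK.measure_lt_top.ne)).integrableOn
  have hwc : ∀ n, Continuous (w n) := fun n => (hwd n).continuous
  have hwt : ∀ n, Continuous (twistedDbar h ψ (w n)) := fun n =>
    continuous_twistedDbar h hR.isOpen hψ.c2 ((hwd n).of_le (by exact_mod_cast le_top))
      ((hwK n).trans hKΩ)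
  have L1 : Tendsto (fun n => ∫ x in Ω, ‖w n x‖ ^ 2) atTop (𝓝 (∫ x in Ω, ‖u x‖ ^ 2)) :=
    tendsto_integral_of_dominated_convergence _
      (fun n => ((hwc n).norm.pow 2).aestronglyMeasurable) (hKi _)
      (fun n => Eventually.of_forall (hbw n)) (Eventually.of_forall fun x => (t0 x).norm.pow 2)
  have L2 : Tendsto (fun n => ∫ x in Ω, ‖twistedDbar h ψ (w n) x‖ ^ 2) atTop
      (𝓝 (∫ x in Ω, ‖twistedDbar h ψ u x‖ ^ 2)) :=
    tendsto_integral_of_dominated_convergence _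
      (fun n => ((hwt n).norm.pow 2).aestronglyMeasurable) (hKi _)
      (fun n => Eventually.of_forall (hbt n)) (Eventually.of_forall fun x => (tt x).norm.pow 2)
  refine le_of_tendsto_of_tendsto' (L1.const_mul _) L2 fun n => ?_
  by_cases hn : w n = 0
  · simp only [hn, Pi.zero_apply, norm_zero]
    simp only [ne_eq, OfNat.ofNat_ne_zero, not_false_eq_true, zero_pow, integral_zero, mul_zero]
    positivity
  · exact lambdaMinusD_mul_le_of_isTestFun h hR hψ
      ⟨hwd n, hK.of_isClosed_subset (isClosed_tsupport _) (hwK n), (hwK n).trans hKΩ, hn⟩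

end

open scoped Manifold ContDiff in
/-- A smooth cutoff function of a compact subset of an open set. -/
theorem exists_contDiff_cutoff {Ω K : Set (ℝ × ℝ)} (hΩ : IsOpen Ω) (hK : IsCompact K)
    (hKΩ : K ⊆ Ω) : ∃ χ : ℝ × ℝ → ℝ, ContDiff ℝ 2 χ ∧ tsupport χ ⊆ Ω ∧ ∀ x ∈ K, χ =ᶠ[𝓝 x] 1 := by
  obtain ⟨f, hf0, hf1, -⟩ := exists_contMDiffMap_zero_one_nhds_of_isClosed (n := 2)
    𝓘(ℝ, ℝ × ℝ) hΩ.isClosed_compl hK.isClosed (disjoint_compl_left_iff_subset.2 hKΩ)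
  refine ⟨f, f.contMDiff.contDiff, fun x hx => ?_, fun x hx => hf1.filter_mono (nhds_le_nhdsSet hx)⟩
  by_contra hxΩ
  exact notMem_tsupport_iff_eventuallyEq.2 (hf0.filter_mono (nhds_le_nhdsSet hxΩ)) hx

theorem lambdaMinusD_le {Ω : Set (ℝ × ℝ)} {B ψ : ℝ × ℝ → ℝ} {m ε : ℝ} (hR : AssumptionR Ω B)
    (hψ : IsScalarPotential Ω B ψ) (hm : ∃ x ∈ Ω, ψ x < m + ε) (hε : 0 < ε) (hεm : 2 * ε ≤ -m) :
    ∃ C > 0, ∀ h > 0, lambdaMinusD h (perpGrad ψ) B Ω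
      ≤ C * h ^ 2 * Real.exp (2 * (m + 2 * ε) / h) := by
  have hΩ := hR.isOpen
  have hcl : IsCompact (closure Ω) := hR.bounded.isCompact_closure
  set K := closure Ω ∩ ψ ⁻¹' Iic (-ε) with hKdef
  have hK : IsCompact K := hcl.of_isClosed_subset
    (hψ.contOn.preimage_isClosed_of_isClosed isClosed_closure isClosed_Iic) inter_subset_left
  have hKΩ : K ⊆ Ω := by
    rintro x ⟨hx, hxε⟩
    by_contra hxΩ
    have := hψ.bdry x (hΩ.frontier_eq ▸ ⟨hx, hxΩ⟩)
    simp only [mem_preimage, mem_Iic] at hxε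
    linarith
  obtain ⟨χ, hχ, hχs, hχ1⟩ := exists_contDiff_cutoff hΩ hK hKΩ
  set w : ℝ × ℝ → ℂ := fun x => (χ x : ℂ) with hw
  have hwd : ContDiff ℝ 2 w := Complex.ofRealCLM.contDiff.comp hχ
  have hws : tsupport w ⊆ Ω :=
    (closure_mono fun y hy => by simpa [hw] using hy : tsupport w ⊆ tsupport χ).trans hχs
  have hwc : HasCompactSupport w :=
    hcl.of_isClosed_subset (isClosed_tsupport _) (hws.trans subset_closure)
  have hw1 : ∀ x ∈ K, w =ᶠ[𝓝 x] fun _ => 1 := fun x hx => by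
    filter_upwards [hχ1 x hx] with y hy
    simp [hw, hy]
  have d1 : Continuous (pd1 w) := (hwd.pd1 (m := 1) (n := 2) (by norm_num)).continuous
  have d2 : Continuous (pd2 w) := (hwd.pd2 (m := 1) (n := 2) (by norm_num)).continuous
  set D : ℝ × ℝ → ℝ := fun x => ‖pd1 w x + Complex.I * pd2 w x‖ ^ 2 with hD
  have hDi : Integrable D := Continuous.integrable_of_hasCompactSupport (by fun_prop)
    (HasCompactSupport.intro hwc.isCompact fun x hx => by
      simp [hD, pd1_eq_zero_of_notMem_tsupport hx, pd2_eq_zero_of_notMem_tsupport hx])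
  have hDK : ∀ x ∈ K, D x = 0 := fun x hx => by
    simp [hD, pd1, pd2, (hw1 x hx).fderiv_eq]
  set U := Ω ∩ ψ ⁻¹' Iio (m + ε) with hU
  have hUo : IsOpen U := (hψ.contOn.mono subset_closure).isOpen_inter_preimage hΩ isOpen_Iio
  have hUK : U ⊆ K := fun x hx => ⟨subset_closure hx.1, by
    have := hx.2
    simp only [mem_preimage, mem_Iio, mem_Iic] at this ⊢
    linarith⟩
  have hUfin : volume U ≠ ⊤ := ((measure_mono hUK).trans_lt hK.measure_lt_top).ne
  have hUne : U.Nonempty := hm.imp fun x hx => ⟨hx.1, hx.2⟩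
  have hV : 0 < volume.real U :=
    ENNReal.toReal_pos (hUo.measure_pos volume hUne).ne' hUfin
  have hI : 0 ≤ ∫ x in Ω, D x := integral_nonneg fun x => by positivity
  refine ⟨(∫ x in Ω, D x) / volume.real U + 1, by positivity, fun h hh => ?_⟩
  set E : ℝ × ℝ → ℂ := fun y => ((Real.exp (-ψ y / h) : ℝ) : ℂ)
  have hEd : ContDiffOn ℝ 2 E Ω := hψ.c2.neg.ofReal_exp_div h
  set u : ℝ × ℝ → ℂ := fun y => E y * w y with hu
  have hud : ContDiff ℝ 2 u :=
    ContDiffOn.contDiff_mul_of_tsupport_subset (n := 2) hΩ hEd hwd hws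
  have huw : tsupport u ⊆ tsupport w := closure_mono (Function.support_mul_subset_right _ _)
  have huc : HasCompactSupport u := hwc.of_isClosed_subset (isClosed_tsupport _) huw
  have hus := huw.trans hws
  have hu0 := hud.continuous
  have hui : Integrable fun x => ‖u x‖ ^ 2 :=
    Continuous.integrable_of_hasCompactSupport (by fun_prop)
      (HasCompactSupport.intro huc.isCompact fun x hx => by
        simp [image_eq_zero_of_notMem_tsupport hx])
  have htc := continuous_twistedDbar h hΩ hψ.c2 (hud.of_le (by norm_num)) hus
  have hti : Integrable fun x => ‖twistedDbar h ψ u x‖ ^ 2 :=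
    Continuous.integrable_of_hasCompactSupport (by fun_prop)
      (HasCompactSupport.intro huc.isCompact fun x hx => by
        simp [twistedDbar_eq_zero_of_notMem_tsupport hx])
  have hnum : ∫ x in Ω, ‖twistedDbar h ψ u x‖ ^ 2
      ≤ h ^ 2 * Real.exp (2 * ε / h) * ∫ x in Ω, D x := by
    rw [← integral_const_mul]
    refine setIntegral_mono_on hti.integrableOn (hDi.integrableOn.const_mul _) hΩ.measurableSet
      fun x hx => ?_
    rw [twistedDbar_exp_mul hh.ne'
        ((hψ.c2.contDiffAt (hΩ.mem_nhds hx)).differentiableAt (by norm_num))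
        (hwd.differentiable (by norm_num) x), norm_mul, norm_mul]
    simp only [mul_pow, Complex.norm_real, Real.norm_eq_abs, Real.abs_exp, sq_abs,
      ← Real.exp_nat_mul]
    by_cases hxK : x ∈ K
    · have h0 : ‖pd1 w x + Complex.I * pd2 w x‖ ^ 2 = 0 := hDK x hxK
      rw [h0, hDK x hxK]
      simp
    · have hxε : -ε < ψ x := by
        by_contra hcon
        exact hxK ⟨subset_closure hx, not_lt.1 hcon⟩
      simp only [hD]
      gcongr
      rw [show ((2 : ℕ) : ℝ) * (-ψ x / h) = 2 * (-ψ x) / h by push_cast; ring]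
      gcongr
      linarith
  have hden : volume.real U * Real.exp (-2 * (m + ε) / h) ≤ ∫ x in Ω, ‖u x‖ ^ 2 := by
    calc volume.real U * Real.exp (-2 * (m + ε) / h)
        = ∫ _ in U, Real.exp (-2 * (m + ε) / h) := by simp
      _ ≤ ∫ x in U, ‖u x‖ ^ 2 := by
        refine setIntegral_mono_on (integrableOn_const hUfin) hui.integrableOn hUo.measurableSet
          fun x hx => ?_
        have hwx : w x = 1 := (hw1 x (hUK hx)).eq_of_nhds
        simp only [hu, E, hwx, mul_one, Complex.norm_real, Real.norm_eq_abs, Real.abs_exp,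
          ← Real.exp_nat_mul]
        have hx2 : ψ x < m + ε := hx.2
        rw [show ((2 : ℕ) : ℝ) * (-ψ x / h) = 2 * (-ψ x) / h by push_cast; ring]
        exact Real.exp_le_exp.2 (div_le_div_of_nonneg_right (by linarith) hh.le)
      _ ≤ ∫ x in Ω, ‖u x‖ ^ 2 :=
        setIntegral_mono_set hui.integrableOn (Eventually.of_forall fun x => by positivity)
          (Eventually.of_forall (inter_subset_left : U ⊆ Ω))
  have hmain := lambdaMinusD_mul_le h hR hψ (hud.of_le (by norm_num)) huc hus
  by_cases hl : lambdaMinusD h (perpGrad ψ) B Ω ≤ 0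
  · exact hl.trans (by positivity)
  push Not at hl
  have h1 : lambdaMinusD h (perpGrad ψ) B Ω * (volume.real U * Real.exp (-2 * (m + ε) / h))
      ≤ h ^ 2 * Real.exp (2 * ε / h) * ∫ x in Ω, D x :=
    (mul_le_mul_of_nonneg_left hden hl.le).trans (hmain.trans hnum)
  rw [← le_div_iff₀ (by positivity)] at h1
  have hexp : Real.exp (2 * (m + 2 * ε) / h)
      = Real.exp (2 * ε / h) / Real.exp (-2 * (m + ε) / h) := by
    rw [← Real.exp_sub]
    congr 1
    ring
  calc lambdaMinusD h (perpGrad ψ) B Ω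
      ≤ h ^ 2 * Real.exp (2 * ε / h) * (∫ x in Ω, D x) /
        (volume.real U * Real.exp (-2 * (m + ε) / h)) := h1
    _ = (∫ x in Ω, D x) / volume.real U * h ^ 2 * Real.exp (2 * (m + 2 * ε) / h) := by
        rw [hexp]
        field_simp
    _ ≤ _ := by
        gcongr
        linarith

theorem log_const_mul_sq_mul_exp {C h : ℝ} (a : ℝ) (hC : 0 < C) (hh : 0 < h) :
    h * Real.log (C * h ^ 2 * Real.exp (a / h)) = h * Real.log C + 2 * (h * Real.log h) + a := by
  rw [Real.log_mul (by positivity) (by positivity), Real.log_mul (by positivity) (by positivity),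
    Real.log_exp, Real.log_pow]
  field_simp
  push_cast
  ring

theorem tendsto_mul_log_add (c a : ℝ) :
    Tendsto (fun h : ℝ => h * c + 2 * (h * Real.log h) + a) (𝓝[>] 0) (𝓝 a) := by
  have hc : Continuous fun h : ℝ => h * c + 2 * (h * Real.log h) + a :=
    ((continuous_id.mul continuous_const).add
      (continuous_const.mul Real.continuous_mul_log)).add continuous_const
  simpa using (hc.tendsto 0).mono_left nhdsWithin_le_nhds

/-- inequality (3.3) / `eq:proofof1.4`: if `inf_Ω ψ₀ < 0` then
`2(inf ψ₀ − sup ψ₀) ≤ liminf h·log λ₋^D ≤ limsup h·log λ₋^D ≤ 2·inf ψ₀` as `h → 0⁺`. -/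
theorem pauli_liminf_limsup_bounds (Ω : Set (ℝ × ℝ)) (B ψ₀ : ℝ × ℝ → ℝ)
    (hR : AssumptionR Ω B) (hsc : SimplyConnectedSpace Ω)
    (hψ : IsScalarPotential Ω B ψ₀) (hneg : sInf (ψ₀ '' Ω) < 0) :
    2 * (sInf (ψ₀ '' Ω) - sSup (ψ₀ '' Ω))
        ≤ liminf (fun h : ℝ => h * Real.log (lambdaMinusD h (perpGrad ψ₀) B Ω)) (𝓝[>] 0) ∧
    liminf (fun h : ℝ => h * Real.log (lambdaMinusD h (perpGrad ψ₀) B Ω)) (𝓝[>] 0)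
        ≤ limsup (fun h : ℝ => h * Real.log (lambdaMinusD h (perpGrad ψ₀) B Ω)) (𝓝[>] 0) ∧
    limsup (fun h : ℝ => h * Real.log (lambdaMinusD h (perpGrad ψ₀) B Ω)) (𝓝[>] 0)
        ≤ 2 * sInf (ψ₀ '' Ω) := by
  set m := sInf (ψ₀ '' Ω) with hm
  set M := sSup (ψ₀ '' Ω) with hM
  set f := fun h : ℝ => h * Real.log (lambdaMinusD h (perpGrad ψ₀) B Ω) with hf
  have hne : Ω.Nonempty := by
    by_contra hcon
    rw [not_nonempty_iff_eq_empty.1 hcon] at hm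
    simp [hm] at hneg
  have hcl : IsCompact (closure Ω) := hR.bounded.isCompact_closure
  have hbdd := (hcl.image_of_continuousOn hψ.contOn).isBounded.subset
    (image_mono subset_closure)
  have hmΩ : ∀ x ∈ Ω, m ≤ ψ₀ x := fun x hx => csInf_le hbdd.bddBelow ⟨x, hx, rfl⟩
  have hMΩ : ∀ x ∈ Ω, ψ₀ x ≤ M := fun x hx => le_csSup hbdd.bddAbove ⟨x, hx, rfl⟩
  obtain ⟨R, hRpos, hRΩ⟩ := hR.bounded.exists_pos_norm_le
  have hlow : ∀ h > 0, 1 / (4 * R ^ 2) * h ^ 2 * Real.exp (2 * (m - M) / h)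
      ≤ lambdaMinusD h (perpGrad ψ₀) B Ω := fun h hh => by
    have := le_lambdaMinusD hh hR hψ hne hRpos
      (fun x hx => (norm_fst_le x).trans (hRΩ x hx)) hmΩ hMΩ
    convert this using 1
    rw [show -2 * (M - m) = 2 * (m - M) by ring]
    ring
  have hlpos : ∀ h > 0, 0 < lambdaMinusD h (perpGrad ψ₀) B Ω := fun h hh =>
    lt_of_lt_of_le (by positivity) (hlow h hh)
  have hge : ∀ᶠ h in 𝓝[>] (0 : ℝ),
      h * Real.log (1 / (4 * R ^ 2)) + 2 * (h * Real.log h) + 2 * (m - M) ≤ f h := by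
    filter_upwards [self_mem_nhdsWithin] with h hh
    have hh : 0 < h := hh
    rw [← log_const_mul_sq_mul_exp _ (by positivity) hh]
    exact mul_le_mul_of_nonneg_left (Real.log_le_log (by positivity) (hlow h hh)) hh.le
  have hle : ∀ ε > 0, 2 * ε ≤ -m → ∃ c, ∀ᶠ h in 𝓝[>] (0 : ℝ),
      f h ≤ h * c + 2 * (h * Real.log h) + 2 * (m + 2 * ε) := by
    intro ε hε hεm
    obtain ⟨_, ⟨x, hx, rfl⟩, hxm⟩ := exists_lt_of_csInf_lt (hne.image ψ₀)
      (lt_add_of_pos_right m hε)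
    obtain ⟨C, hC, hCle⟩ := lambdaMinusD_le hR hψ ⟨x, hx, hxm⟩ hε hεm
    refine ⟨Real.log C, ?_⟩
    filter_upwards [self_mem_nhdsWithin] with h hh
    have hh : 0 < h := hh
    rw [← log_const_mul_sq_mul_exp _ hC hh]
    exact mul_le_mul_of_nonneg_left (Real.log_le_log (hlpos h hh) (hCle h hh)) hh.le
  have hbelow : IsBoundedUnder (· ≥ ·) (𝓝[>] (0 : ℝ)) f :=
    (tendsto_mul_log_add _ _).isBoundedUnder_ge.mono_ge hge
  have habove : IsBoundedUnder (· ≤ ·) (𝓝[>] (0 : ℝ)) f := by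
    obtain ⟨c, hc⟩ := hle (-m / 2) (by linarith) (by linarith)
    exact (tendsto_mul_log_add _ _).isBoundedUnder_le.mono_le hc
  refine ⟨?_, liminf_le_limsup habove hbelow, ?_⟩
  · rw [← (tendsto_mul_log_add (Real.log (1 / (4 * R ^ 2))) (2 * (m - M))).liminf_eq]
    exact liminf_le_liminf hge (tendsto_mul_log_add _ _).isBoundedUnder_ge
      habove.isCoboundedUnder_ge
  · refine le_of_forall_pos_le_add fun δ hδ => ?_
    obtain ⟨c, hc⟩ := hle (min (δ / 4) (-m / 2)) (lt_min (by linarith) (by linarith))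
      (by linarith [min_le_right (δ / 4) (-m / 2)])
    have hlim := limsup_le_limsup hc hbelow.isCoboundedUnder_le
      (tendsto_mul_log_add c _).isBoundedUnder_le
    rw [(tendsto_mul_log_add c _).limsup_eq] at hlim
    linarith [min_le_left (δ / 4) (-m / 2)]
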